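/- Let n ≥ 1, let 0 ≤ T < θ be real numbers, let K ≥ 0 and let Y : [T,θ] → ℝⁿ be C¹. Let h, g : [T,θ] → ℝ be continuous and assume that for all t ∈ [T,θ]: |Y'(t) − (4t/(1+4t²)) Y(t)| ≤ |h(t)| |Y(t)| + |g(t)| + K/⟨2t⟩. Then for all t ∈ [T,θ]: |Y(t)| ≤ ( (⟨2t⟩/⟨2θ⟩) |Y(θ)| + ∫_T^θ |g(s)| ds + K ) · exp( ∫_T^θ |h(s)| ds ). -/

import Mathlib

open Set

noncomputable section

namespace Paper

/-- `⟨s⟩ = (1 + s²)^{1/2}` for a real number `s`. -/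
def jbr (t : ℝ) : ℝ := Real.sqrt (1 + t ^ 2)

theorem jbr_pos (t : ℝ) : 0 < jbr t := Real.sqrt_pos.2 (by positivity)

theorem jbr_sq (t : ℝ) : jbr t ^ 2 = 1 + t ^ 2 := Real.sq_sqrt (by positivity)

theorem jbr_le_jbr {s t : ℝ} (hs : 0 ≤ s) (hst : s ≤ t) : jbr s ≤ jbr t :=
  Real.sqrt_le_sqrt (by gcongr)

theorem hasDerivAt_jbr_two_mul (t : ℝ) :
    HasDerivAt (fun s => jbr (2 * s)) (4 * t / jbr (2 * t)) t := by
  have h1 : HasDerivAt (fun s : ℝ => 1 + (2 * s) ^ 2) (8 * t) t := by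
    have := (((hasDerivAt_id t).const_mul 2).pow 2).const_add 1
    refine this.congr_deriv ?_
    norm_num
    ring
  have h2 := h1.sqrt (by positivity)
  refine h2.congr_deriv ?_
  symm
  change 4 * t / jbr (2 * t) = 8 * t / (2 * jbr (2 * t))
  rw [show 8 * t = 2 * (4 * t) by ring, mul_div_mul_left _ _ two_ne_zero]

theorem continuousOn_integral_left {f : ℝ → ℝ} {a b : ℝ} (hab : a ≤ b)
    (hf : ContinuousOn f (Icc a b)) :
    ContinuousOn (fun t => ∫ s in t..b, f s) (Icc a b) := by
  have h := intervalIntegral.continuousOn_primitive_interval_left (μ := MeasureTheory.volume)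
    (f := f) (a := a) (b := b)
    (by rw [uIcc_of_le hab]; exact hf.integrableOn_Icc)
  rwa [uIcc_of_le hab] at h

theorem hasDerivAt_integral_left {f : ℝ → ℝ} {a b t : ℝ}
    (hf : ContinuousOn f (Icc a b)) (ht : t ∈ Ioo a b) :
    HasDerivAt (fun t => ∫ s in t..b, f s) (-f t) t := by
  have hmem : Icc a b ∈ nhds t := Icc_mem_nhds ht.1 ht.2
  refine intervalIntegral.integral_hasDerivAt_left ?_ ?_ (hf.continuousAt hmem)
  · refine (hf.mono ?_).intervalIntegrable
    rw [uIcc_of_le ht.2.le]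
    exact Icc_subset_Icc_left ht.1.le
  · exact (hf.mono Ioo_subset_Icc_self).stronglyMeasurableAtFilter isOpen_Ioo t ht

/-- A backward Grönwall inequality in integral form. -/
theorem le_mul_exp_of_le_integral {u k φ : ℝ → ℝ} {a b c : ℝ} (hab : a ≤ b)
    (hu : ContinuousOn u (Icc a b)) (hk : ContinuousOn k (Icc a b))
    (hφ : ContinuousOn φ (Icc a b)) (hk0 : ∀ t ∈ Icc a b, 0 ≤ k t)
    (hφ0 : ∀ t ∈ Icc a b, 0 ≤ φ t)
    (hle : ∀ t ∈ Icc a b, u t ≤ c + ∫ s in t..b, (k s * u s + φ s)) :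
    u a ≤ (c + ∫ s in a..b, φ s) * Real.exp (∫ s in a..b, k s) := by
  have hm : ContinuousOn (fun s => k s * u s + φ s) (Icc a b) := (hk.mul hu).add hφ
  set R : ℝ → ℝ := fun t => c + ∫ s in t..b, (k s * u s + φ s) with hR
  set H : ℝ → ℝ := fun t => ∫ s in t..b, k s with hH
  set Φ : ℝ → ℝ := fun t => ∫ s in t..b, φ s with hΦ
  have hmono : MonotoneOn (fun t => R t * Real.exp (-H t) - Φ t) (Icc a b) := by
    refine monotoneOn_of_hasDerivWithinAt_nonneg (f' := fun t =>
      (-(k t * u t + φ t)) * Real.exp (-H t) + R t * (Real.exp (-H t) * (- -k t)) - (-φ t))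
      (convex_Icc a b) ?_ ?_ ?_
    · exact ((continuousOn_const.add (continuousOn_integral_left hab hm)).mul
        (continuousOn_integral_left hab hk).neg.rexp).sub (continuousOn_integral_left hab hφ)
    · intro t ht
      rw [interior_Icc] at ht
      exact ((((hasDerivAt_integral_left hm ht).const_add c).mul
        (hasDerivAt_integral_left hk ht).neg.exp).sub
        (hasDerivAt_integral_left hφ ht)).hasDerivWithinAt
    · intro t ht
      rw [interior_Icc] at ht
      have htI : t ∈ Icc a b := Ioo_subset_Icc_self ht
      have hH0 : 0 ≤ H t := intervalIntegral.integral_nonneg ht.2.le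
        fun s hs => hk0 s ⟨ht.1.le.trans hs.1, hs.2⟩
      have hE : Real.exp (-H t) ≤ 1 := Real.exp_le_one_iff.2 (by linarith)
      have h1 : 0 ≤ k t * (R t - u t) * Real.exp (-H t) :=
        mul_nonneg (mul_nonneg (hk0 t htI) (sub_nonneg.2 (hle t htI))) (Real.exp_pos _).le
      have h2 : 0 ≤ φ t * (1 - Real.exp (-H t)) := mul_nonneg (hφ0 t htI) (sub_nonneg.2 hE)
      linarith
  have h := hmono (left_mem_Icc.2 hab) (right_mem_Icc.2 hab) hab
  simp only [hR, hH, hΦ, intervalIntegral.integral_same, neg_zero, Real.exp_zero, mul_one,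
    add_zero, sub_zero] at h
  refine (hle a (left_mem_Icc.2 hab)).trans ?_
  rw [sub_le_iff_le_add, Real.exp_neg, ← div_eq_mul_inv, div_le_iff₀ (Real.exp_pos _)] at h
  exact h

theorem integral_inv_one_add_two_mul_sq (a b : ℝ) :
    ∫ s in a..b, (1 + (2 * s) ^ 2)⁻¹ = (Real.arctan (2 * b) - Real.arctan (2 * a)) / 2 := by
  rw [intervalIntegral.integral_comp_mul_left (fun x : ℝ => (1 + x ^ 2)⁻¹) two_ne_zero,
    integral_inv_one_add_sq, smul_eq_mul]
  ring

theorem jbr_mul_integral_le_one {a : ℝ} (b : ℝ) (ha : 0 ≤ a) :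
    jbr (2 * a) * ∫ s in a..b, (1 + (2 * s) ^ 2)⁻¹ ≤ 1 := by
  rw [integral_inv_one_add_two_mul_sq]
  have hp := jbr_pos (2 * a)
  have h0 : 0 ≤ Real.arctan (2 * a) := Real.arctan_nonneg.2 (by positivity)
  have h1 := Real.arctan_lt_pi_div_two (2 * a)
  have h2 := Real.arctan_lt_pi_div_two (2 * b)
  have h3 := Real.mul_le_sin (x := Real.pi / 2 - Real.arctan (2 * a)) (by linarith) (by linarith)
  rw [Real.sin_pi_div_two_sub, Real.cos_arctan] at h3
  change _ ≤ 1 / jbr (2 * a) at h3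
  rw [le_div_iff₀ hp, div_mul_eq_mul_div, div_mul_eq_mul_div, div_le_one Real.pi_pos] at h3
  have h4 := Real.pi_le_four
  nlinarith

/-- A backward Grönwall inequality for vector-valued functions. -/
theorem norm_le_mul_exp_of_norm_deriv_le {E : Type*} [NormedAddCommGroup E] [NormedSpace ℝ E]
    [CompleteSpace E] {Z Z' : ℝ → E} {k φ : ℝ → ℝ} {a b : ℝ} (hab : a ≤ b)
    (hZ' : ContinuousOn Z' (Icc a b))
    (hZ : ∀ t ∈ Icc a b, HasDerivWithinAt Z (Z' t) (Icc a b) t)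
    (hk : ContinuousOn k (Icc a b)) (hφ : ContinuousOn φ (Icc a b))
    (hk0 : ∀ t ∈ Icc a b, 0 ≤ k t) (hφ0 : ∀ t ∈ Icc a b, 0 ≤ φ t)
    (hle : ∀ t ∈ Icc a b, ‖Z' t‖ ≤ k t * ‖Z t‖ + φ t) :
    ‖Z a‖ ≤ (‖Z b‖ + ∫ s in a..b, φ s) * Real.exp (∫ s in a..b, k s) := by
  have hZc : ContinuousOn Z (Icc a b) := fun t ht => (hZ t ht).continuousWithinAt
  refine le_mul_exp_of_le_integral (u := fun t => ‖Z t‖) hab hZc.norm hk hφ hk0 hφ0 ?_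
  intro t ht
  have hsub : Icc t b ⊆ Icc a b := Icc_subset_Icc_left ht.1
  have hint : ∫ s in t..b, Z' s = Z b - Z t := by
    refine intervalIntegral.integral_eq_sub_of_hasDerivAt_of_le ht.2 (hZc.mono hsub) ?_ ?_
    · intro s hs
      exact (hZ s (hsub (Ioo_subset_Icc_self hs))).hasDerivAt
        (Icc_mem_nhds (ht.1.trans_lt hs.1) hs.2)
    · exact (hZ'.mono hsub).intervalIntegrable_of_Icc ht.2
  have h1 : ‖∫ s in t..b, Z' s‖ ≤ ∫ s in t..b, (k s * ‖Z s‖ + φ s) := by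
    refine (intervalIntegral.norm_integral_le_integral_norm ht.2).trans ?_
    refine intervalIntegral.integral_mono_on ht.2
      ((hZ'.mono hsub).norm.intervalIntegrable_of_Icc ht.2)
      ((((hk.mul hZc.norm).add hφ).mono hsub).intervalIntegrable_of_Icc ht.2)
      fun s hs => hle s (hsub hs)
  have h2 : Z t = Z b - ∫ s in t..b, Z' s := by rw [hint]; abel
  calc ‖Z t‖ ≤ ‖Z b‖ + ‖∫ s in t..b, Z' s‖ := by
        conv_lhs => rw [h2]
        exact norm_sub_le _ _
    _ ≤ _ := by gcongr

/-- **Lemma V.3.9.** Let `0 ≤ T < θ`, `K ≥ 0` and `Y : [T,θ] → ℝⁿ` be `C¹` with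
`|Y'(t) − (4t/(1+4t²)) Y(t)| ≤ |h(t)||Y(t)| + |g(t)| + K/⟨2t⟩` for continuous `h, g`.
Then `|Y(t)| ≤ ((⟨2t⟩/⟨2θ⟩)|Y(θ)| + ∫_T^θ |g(s)| ds + K) exp(∫_T^θ |h(s)| ds)`. -/
theorem statement17 (n : ℕ) (hn : 1 ≤ n) (T θ : ℝ) (hT : 0 ≤ T) (hTθ : T < θ)
    (K : ℝ) (hK : 0 ≤ K)
    (Y Y' : ℝ → EuclideanSpace ℝ (Fin n))
    (hY'cont : ContinuousOn Y' (Icc T θ))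
    (hYderiv : ∀ t ∈ Icc T θ, HasDerivWithinAt Y (Y' t) (Icc T θ) t)
    (h g : ℝ → ℝ) (hh : ContinuousOn h (Icc T θ)) (hg : ContinuousOn g (Icc T θ))
    (hineq : ∀ t ∈ Icc T θ,
      ‖Y' t - (4 * t / (1 + 4 * t ^ 2)) • Y t‖ ≤
        |h t| * ‖Y t‖ + |g t| + K / jbr (2 * t)) :
    ∀ t ∈ Icc T θ,
      ‖Y t‖ ≤
        (jbr (2 * t) / jbr (2 * θ) * ‖Y θ‖ + (∫ s in T..θ, |g s|) + K) *
          Real.exp (∫ s in T..θ, |h s|) := by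
  intro t ht
  have ht0 : 0 ≤ t := hT.trans ht.1
  have hsub : Icc t θ ⊆ Icc T θ := Icc_subset_Icc_left ht.1
  have hp : ∀ s, 0 < jbr (2 * s) := fun s => jbr_pos _
  have hYc : ContinuousOn Y (Icc T θ) := fun s hs => (hYderiv s hs).continuousWithinAt
  have hjc : Continuous fun s => jbr (2 * s) :=
    continuous_iff_continuousAt.2 fun s => (hasDerivAt_jbr_two_mul s).continuousAt
  have hjic : Continuous fun s => (jbr (2 * s))⁻¹ := hjc.inv₀ fun s => (hp s).ne'
  have hqc : Continuous fun s : ℝ => (1 + (2 * s) ^ 2)⁻¹ :=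
    Continuous.inv₀ (by fun_prop) fun s => by positivity
  have hcc : Continuous fun s : ℝ => 4 * s / (1 + 4 * s ^ 2) :=
    Continuous.div (by fun_prop) (by fun_prop) fun s => by positivity
  have hga : ContinuousOn (fun s => |g s|) (Icc t θ) := (hg.mono hsub).abs
  have key := norm_le_mul_exp_of_norm_deriv_le (a := t) (b := θ)
    (Z := fun s => (jbr (2 * s))⁻¹ • Y s)
    (Z' := fun s => (jbr (2 * s))⁻¹ • (Y' s - (4 * s / (1 + 4 * s ^ 2)) • Y s))
    (k := fun s => |h s|)
    (φ := fun s => (jbr (2 * t))⁻¹ * |g s| + K * (1 + (2 * s) ^ 2)⁻¹) ht.2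
    ((hjic.continuousOn.smul (hY'cont.sub (hcc.continuousOn.smul hYc))).mono hsub)
    ?_ (hh.mono hsub).abs
    ((continuousOn_const.mul hga).add (continuousOn_const.mul hqc.continuousOn))
    (fun s _ => abs_nonneg _)
    (fun s _ => by have := hp t; positivity) ?_
  · have hphi : ∫ s in t..θ, ((jbr (2 * t))⁻¹ * |g s| + K * (1 + (2 * s) ^ 2)⁻¹) =
        (jbr (2 * t))⁻¹ * (∫ s in t..θ, |g s|) + K * ∫ s in t..θ, (1 + (2 * s) ^ 2)⁻¹ := by
      rw [intervalIntegral.integral_add, intervalIntegral.integral_const_mul,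
        intervalIntegral.integral_const_mul]
      · exact (continuousOn_const.mul hga).intervalIntegrable_of_Icc ht.2
      · exact (continuous_const.mul hqc).intervalIntegrable _ _
    have hmono : ∀ f : ℝ → ℝ, ContinuousOn f (Icc T θ) →
        ∫ s in t..θ, |f s| ≤ ∫ s in T..θ, |f s| := fun f hf =>
      intervalIntegral.integral_mono_interval ht.1 ht.2 le_rfl
        (Filter.Eventually.of_forall fun s => abs_nonneg _)
        (hf.abs.intervalIntegrable_of_Icc hTθ.le)
    have hg0 : 0 ≤ ∫ s in t..θ, |g s| :=
      intervalIntegral.integral_nonneg ht.2 fun s _ => abs_nonneg _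
    have hK1 := mul_le_mul_of_nonneg_left (jbr_mul_integral_le_one θ ht0) hK
    rw [hphi, norm_smul, norm_smul, Real.norm_of_nonneg (inv_nonneg.2 (hp t).le),
      Real.norm_of_nonneg (inv_nonneg.2 (hp θ).le), inv_mul_le_iff₀ (hp t), ← mul_assoc] at key
    refine key.trans ?_
    have hb : jbr (2 * t) * ((jbr (2 * θ))⁻¹ * ‖Y θ‖ + ((jbr (2 * t))⁻¹ * (∫ s in t..θ, |g s|) +
        K * ∫ s in t..θ, (1 + (2 * s) ^ 2)⁻¹)) =
        jbr (2 * t) / jbr (2 * θ) * ‖Y θ‖ + (∫ s in t..θ, |g s|) +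
          K * (jbr (2 * t) * ∫ s in t..θ, (1 + (2 * s) ^ 2)⁻¹) := by
      have := (hp t).ne'
      have := (hp θ).ne'
      field_simp
      ring
    rw [hb]
    have hc : 0 ≤ jbr (2 * t) / jbr (2 * θ) * ‖Y θ‖ :=
      mul_nonneg (div_nonneg (hp t).le (hp θ).le) (norm_nonneg _)
    have hgm := hmono g hg
    refine mul_le_mul (by linarith) (Real.exp_le_exp.2 (hmono h hh)) (Real.exp_pos _).le
      (by linarith)
  · intro s hs
    have hd := ((hasDerivAt_jbr_two_mul s).inv (hp s).ne').hasDerivWithinAt (s := Icc t θ)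
    refine (hd.smul ((hYderiv s (hsub hs)).mono hsub)).congr_deriv ?_
    have hsq : 1 + 4 * s ^ 2 = jbr (2 * s) ^ 2 := by rw [jbr_sq]; ring
    have hps := (hp s).ne'
    rw [hsq, smul_sub, smul_smul, sub_eq_add_neg, ← neg_smul]
    congr 2
    field_simp
  · intro s hs
    have hi := inv_nonneg.2 (hp s).le
    have hle := mul_le_mul_of_nonneg_left (hineq s (hsub hs)) hi
    have hinv : (jbr (2 * s))⁻¹ ≤ (jbr (2 * t))⁻¹ :=
      inv_anti₀ (hp t) (jbr_le_jbr (by positivity) (by linarith [hs.1]))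
    have hgs := mul_le_mul_of_nonneg_right hinv (abs_nonneg (g s))
    have hKs : (jbr (2 * s))⁻¹ * (K / jbr (2 * s)) = K * (1 + (2 * s) ^ 2)⁻¹ := by
      rw [← jbr_sq]
      have := (hp s).ne'
      field_simp
    rw [norm_smul, norm_smul, Real.norm_of_nonneg hi]
    rw [mul_add, mul_add, hKs] at hle
    linarith

end Paper
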